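/- Let I and J be squarefree monomial ideals of S with the same Z^v-graded Hilbert series. Then their Alexander duals I* and J* also have the same Z^v-graded Hilbert series. -/

import Mathlib

open MvPolynomial

noncomputable section

namespace CSPaper

/-- The set of variables of the standard `ℤ^v`-graded polynomial ring `S`:
the variable `x_{i j}` of the paper (with `1 ≤ i ≤ v`, `1 ≤ j ≤ n_i`) corresponds to
`⟨i-1, j-1⟩ : MVar v n` where `n (i-1) = n_i - 1`; thus row `i` has `n i + 1 > 0`
variables and the first variable `x_{i 1}` of row `i` corresponds to `⟨i, 0⟩`. -/
abbrev MVar (v : ℕ) (n : Fin v → ℕ) : Type := Σ i : Fin v, Fin (n i + 1)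

/-- The weight function giving the standard `ℤ^v`-grading: `deg (x_{i j}) = e_i ∈ ℤ^v`. -/
def wt (v : ℕ) (n : Fin v → ℕ) : MVar v n → (Fin v → ℕ) := fun p => Pi.single p.1 1

variable {K : Type} [Field K] {v : ℕ} {n : Fin v → ℕ}

/-- An ideal of `S` is `ℤ^v`-graded (multigraded) iff it contains every multihomogeneous
component of each of its elements. -/
def IsMultigraded (I : Ideal (MvPolynomial (MVar v n) K)) : Prop :=
  ∀ f ∈ I, ∀ a : Fin v → ℕ, weightedHomogeneousComponent (wt v n) a f ∈ I

/-- The value of the `ℤ^v`-graded Hilbert function of the ideal `I` at `a ∈ ℕ^v`: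
`dim_K I_a`. -/
def hilb (I : Ideal (MvPolynomial (MVar v n) K)) (a : Fin v → ℕ) : ℕ :=
  Module.finrank K
    ((Submodule.restrictScalars K I ⊓ weightedHomogeneousSubmodule K (wt v n) a :
      Submodule K (MvPolynomial (MVar v n) K)))

/-- Two ideals have the same `ℤ^v`-graded Hilbert series. -/
def sameHS (I J : Ideal (MvPolynomial (MVar v n) K)) : Prop :=
  ∀ a : Fin v → ℕ, hilb I a = hilb J a

/-- The `ℤ^v`-graded `K`-algebra endomorphism of `S` determined by a `v`-tuple of square
matrices: `x_{i j} ↦ ∑_k (g i)_{k j} x_{i k}`.  For invertible `g i` these are exactly the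
elements of `G = GL_{n_1}(K) × ⋯ × GL_{n_v}(K)` acting on `S`. -/
def gAct (g : ∀ i : Fin v, Matrix (Fin (n i + 1)) (Fin (n i + 1)) K) :
    MvPolynomial (MVar v n) K →ₐ[K] MvPolynomial (MVar v n) K :=
  aeval fun p : MVar v n => ∑ k : Fin (n p.1 + 1), C (g p.1 k p.2) * X ⟨p.1, k⟩

/-- A property `P` of `v`-tuples of matrices holds generically (i.e. for a general
`g ∈ GL_{n_1}(K) × ⋯ × GL_{n_v}(K)`) if there is a nonzero polynomial `h` in the matrix
entries such that `P g` holds for every invertible `g` with `h(g) ≠ 0`. -/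
def Generically
    (P : (∀ i : Fin v, Matrix (Fin (n i + 1)) (Fin (n i + 1)) K) → Prop) : Prop :=
  ∃ h : MvPolynomial (Σ i : Fin v, Fin (n i + 1) × Fin (n i + 1)) K, h ≠ 0 ∧
    ∀ g : ∀ i : Fin v, Matrix (Fin (n i + 1)) (Fin (n i + 1)) K,
      (∀ i, IsUnit (g i).det) →
      eval (fun q : Σ i : Fin v, Fin (n i + 1) × Fin (n i + 1) => g q.1 q.2.1 q.2.2) h ≠ 0 →
      P g

/-- The leading exponent (exponent of the leading monomial) of a polynomial with respect to
a term order `τ` (a `MonomialOrder`); by convention `leadExp τ 0 = 0`. -/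
def leadExp (τ : MonomialOrder (MVar v n)) (f : MvPolynomial (MVar v n) K) :
    MVar v n →₀ ℕ :=
  τ.toSyn.symm (f.support.sup τ.toSyn)

/-- The initial ideal `in_τ(I)`: the monomial ideal generated by the leading monomials of the
nonzero elements of `I`. -/
def inIdeal (τ : MonomialOrder (MVar v n)) (I : Ideal (MvPolynomial (MVar v n) K)) :
    Ideal (MvPolynomial (MVar v n) K) :=
  Ideal.span {m | ∃ f ∈ I, f ≠ 0 ∧ m = monomial (leadExp τ f) (1 : K)}

/-- `G` is a Gröbner basis of `I` with respect to the term order `τ`. -/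
def IsGroebnerBasis (τ : MonomialOrder (MVar v n)) (G : Set (MvPolynomial (MVar v n) K))
    (I : Ideal (MvPolynomial (MVar v n) K)) : Prop :=
  G ⊆ (I : Set (MvPolynomial (MVar v n) K)) ∧
    Ideal.span ((fun f => monomial (leadExp τ f) (1 : K)) '' {f ∈ G | f ≠ 0}) = inIdeal τ I

/-- `J = gin_τ(I)`, the `ℤ^v`-graded generic initial ideal: for a general
`g ∈ GL_{n_1}(K) × ⋯ × GL_{n_v}(K)` one has `in_τ(g(I)) = J`. -/
def IsGin (τ : MonomialOrder (MVar v n)) (I J : Ideal (MvPolynomial (MVar v n) K)) : Prop :=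
  Generically fun g => inIdeal τ (Ideal.map (gAct g) I) = J

/-- A term order such that `x_{i j} > x_{i k}` whenever `j < k`. -/
def RespectsVarOrder (τ : MonomialOrder (MVar v n)) : Prop :=
  ∀ (i : Fin v) (j k : Fin (n i + 1)), j < k →
    τ.toSyn (Finsupp.single (⟨i, k⟩ : MVar v n) 1) <
      τ.toSyn (Finsupp.single (⟨i, j⟩ : MVar v n) 1)

/-- An ideal is Borel fixed if it is fixed by every element of the Borel subgroup
`B = B_{n_1}(K) × ⋯ × B_{n_v}(K)` of upper triangular invertible matrices (upper triangular
with respect to the order `x_{i 1} > x_{i 2} > ⋯` of the variables in each row). -/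
def BorelFixed (I : Ideal (MvPolynomial (MVar v n) K)) : Prop :=
  ∀ g : ∀ i : Fin v, Matrix (Fin (n i + 1)) (Fin (n i + 1)) K,
    (∀ i, IsUnit (g i).det) →
    (∀ (i : Fin v) (k j : Fin (n i + 1)), j < k → g i k j = 0) →
    Ideal.map (gAct g) I = I

/-- A Cartwright-Sturmfels ideal: a `ℤ^v`-graded ideal with the same `ℤ^v`-graded Hilbert
series as some radical Borel fixed ideal. -/
def IsCS (I : Ideal (MvPolynomial (MVar v n) K)) : Prop :=
  IsMultigraded I ∧ ∃ J : Ideal (MvPolynomial (MVar v n) K),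
    J.IsRadical ∧ BorelFixed J ∧ sameHS I J

/-- The exponent of the monomial `x_{1 1}^{a 1} ⋯ x_{v 1}^{a v}` of
`T = K[x_{1 1}, …, x_{v 1}] ⊆ S`. -/
def Tmono (v : ℕ) (n : Fin v → ℕ) (a : Fin v → ℕ) : MVar v n →₀ ℕ :=
  ∑ i : Fin v, Finsupp.single (⟨i, 0⟩ : MVar v n) (a i)

/-- A `ℤ^v`-graded ideal of `S` extended from `T`, i.e. generated by monomials in the
variables `x_{1 1}, …, x_{v 1}`. -/
def ExtendedFromT (J : Ideal (MvPolynomial (MVar v n) K)) : Prop :=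
  ∃ A : Set (Fin v → ℕ),
    J = Ideal.span ((fun a => monomial (Tmono v n a) (1 : K)) '' A)

/-- A Cartwright-Sturmfels* ideal: a `ℤ^v`-graded ideal with the same `ℤ^v`-graded Hilbert
series as some ideal extended from `T`. -/
def IsCSstar (J : Ideal (MvPolynomial (MVar v n) K)) : Prop :=
  IsMultigraded J ∧ ∃ C : Ideal (MvPolynomial (MVar v n) K), ExtendedFromT C ∧ sameHS J C

/-- A monomial ideal. -/
def IsMonomialIdeal (I : Ideal (MvPolynomial (MVar v n) K)) : Prop :=
  ∃ A : Set (MVar v n →₀ ℕ), I = Ideal.span ((fun s => monomial s (1 : K)) '' A)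

/-- A squarefree monomial ideal. -/
def IsSqfreeMonomialIdeal (I : Ideal (MvPolynomial (MVar v n) K)) : Prop :=
  ∃ A : Set (MVar v n →₀ ℕ), (∀ s ∈ A, ∀ x, s x ≤ 1) ∧
    I = Ideal.span ((fun s => monomial s (1 : K)) '' A)

/-- `J` is the Alexander dual of the squarefree monomial ideal `I`: `J` is generated by the
products `∏_{x ∈ P} x` as `P` ranges over the minimal primes of `I`. -/
def IsAlexanderDual (I J : Ideal (MvPolynomial (MVar v n) K)) : Prop :=
  J = Ideal.span {m | ∃ F : Finset (MVar v n),
    Ideal.span ((fun x => (X x : MvPolynomial (MVar v n) K)) '' ↑F) ∈ I.minimalPrimes ∧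
    m = ∏ x ∈ F, X x}

/-- The sequence `x_{i j} - λ_{i j} x_{i 1}`, `1 ≤ i ≤ v`, `2 ≤ j ≤ n_i`, as a list. -/
def LamList (lam : MVar v n → K) : List (MvPolynomial (MVar v n) K) :=
  (List.finRange v).flatMap fun i =>
    ((List.finRange (n i + 1)).drop 1).map fun j =>
      X (⟨i, j⟩ : MVar v n) - C (lam ⟨i, j⟩) * X (⟨i, 0⟩ : MVar v n)

/-- A property of the scalars `λ = (λ_{i j})` holds for general `λ ∈ K^N` if there is a
nonzero polynomial `h` in the `λ_{i j}` such that the property holds whenever `h(λ) ≠ 0`. -/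
def GenericallyLam {v : ℕ} {n : Fin v → ℕ} (K : Type) [Field K]
    (P : (MVar v n → K) → Prop) : Prop :=
  ∃ h : MvPolynomial (MVar v n) K, h ≠ 0 ∧
    ∀ lam : MVar v n → K, eval lam h ≠ 0 → P lam

variable {K : Type} [Field K] {v : ℕ} {n : Fin v → ℕ}

/-- A graded free resolution of an ideal `I` of a polynomial ring graded by an additive
monoid `M` via a weight function `w` on the variables:
`⋯ → F_2 → F_1 → F_0 → I → 0`, where `F_p` is the free module with (finite) basis `ι p`,
the basis element `i : ι p` having degree `deg p i ∈ M`, all maps are graded of degree `0`,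
and the complex is exact. -/
structure GradedFreeResolution (σ : Type) (K : Type) [Field K] (M : Type) [AddCommMonoid M]
    (w : σ → M) (I : Ideal (MvPolynomial σ K)) where
  ι : ℕ → Type
  finite : ∀ p, Finite (ι p)
  deg : ∀ p, ι p → M
  aug : (ι 0 →₀ MvPolynomial σ K) →ₗ[MvPolynomial σ K] MvPolynomial σ K
  d : ∀ p, (ι (p + 1) →₀ MvPolynomial σ K) →ₗ[MvPolynomial σ K] (ι p →₀ MvPolynomial σ K)
  aug_graded : ∀ i : ι 0, (aug (Finsupp.single i 1)).IsWeightedHomogeneous w (deg 0 i)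
  d_graded : ∀ (p : ℕ) (i : ι (p + 1)) (j : ι p),
    (d p (Finsupp.single i 1)) j = 0 ∨
      ∃ b, ((d p (Finsupp.single i 1)) j).IsWeightedHomogeneous w b ∧
        b + deg p j = deg (p + 1) i
  range_aug : LinearMap.range aug = (I : Submodule (MvPolynomial σ K) (MvPolynomial σ K))
  exact_zero : LinearMap.ker aug = LinearMap.range (d 0)
  exact : ∀ p, LinearMap.ker (d p) = LinearMap.range (d (p + 1))

/-- A graded free resolution is minimal if all entries of the matrices of the differentials
between free modules lie in the irrelevant maximal ideal, i.e. have zero constant term. -/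
def GradedFreeResolution.Minimal {σ M : Type} [AddCommMonoid M] {w : σ → M}
    {I : Ideal (MvPolynomial σ K)} (F : GradedFreeResolution σ K M w I) : Prop :=
  ∀ (p : ℕ) (i : F.ι (p + 1)) (j : F.ι p),
    MvPolynomial.constantCoeff ((F.d p (Finsupp.single i 1)) j) = 0

/-- The graded Betti number `β_{p,a}` read off from a (minimal) graded free resolution:
the number of basis elements of `F_p` of degree `a`. -/
def GradedFreeResolution.betti {σ M : Type} [AddCommMonoid M] {w : σ → M}
    {I : Ideal (MvPolynomial σ K)} (F : GradedFreeResolution σ K M w I) (p : ℕ) (a : M) :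
    ℕ :=
  Nat.card {i : F.ι p // F.deg p i = a}

/-- The set of `t × t` minors of the matrix `A`. -/
def minorsSet {R : Type} [CommRing R] (t : ℕ) {m N : ℕ} (A : Matrix (Fin m) (Fin N) R) :
    Set R :=
  {d | ∃ (r : Fin t → Fin m) (c : Fin t → Fin N),
    Function.Injective r ∧ Function.Injective c ∧ d = (A.submatrix r c).det}

/-- `I_t(A)`, the ideal generated by the `t × t` minors of `A`. -/
def minorsIdeal {R : Type} [CommRing R] (t : ℕ) {m N : ℕ}
    (A : Matrix (Fin m) (Fin N) R) : Ideal R :=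
  Ideal.span (minorsSet t A)

/-- `A` is column-graded: `N ≤ v` and each entry of the `j`-th column is either `0` or
multihomogeneous of degree `e_j ∈ ℤ^v`. -/
def ColumnGraded {m N : ℕ} (A : Matrix (Fin m) (Fin N) (MvPolynomial (MVar v n) K)) :
    Prop :=
  ∃ h : N ≤ v, ∀ i j, A i j = 0 ∨
    (A i j).IsWeightedHomogeneous (wt v n) (Pi.single (Fin.castLE h j) 1)

/-- `A` is row-graded: `m ≤ v` and each entry of the `i`-th row is either `0` or
multihomogeneous of degree `e_i ∈ ℤ^v`. -/
def RowGraded {m N : ℕ} (A : Matrix (Fin m) (Fin N) (MvPolynomial (MVar v n) K)) : Prop :=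
  ∃ h : m ≤ v, ∀ i j, A i j = 0 ∨
    (A i j).IsWeightedHomogeneous (wt v n) (Pi.single (Fin.castLE h i) 1)

/-- The exponent of the polarization of the monomial `x_{1 1}^{a 1} ⋯ x_{v 1}^{a v}` of `T`:
the squarefree monomial `∏_i x_{i 1} x_{i 2} ⋯ x_{i (a i)}`. -/
def polExp (v : ℕ) (n : Fin v → ℕ) (a : Fin v → ℕ) : MVar v n →₀ ℕ :=
  ∑ i : Fin v, ∑ j ∈ Finset.univ.filter (fun j : Fin (n i + 1) => (j : ℕ) < a i),
    Finsupp.single (⟨i, j⟩ : MVar v n) 1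

/-- `P = pol(C)`, the polarization of an ideal `C` extended from `T`
(the exponents of the generators of `C` must fit inside `S`). -/
def IsPolarizationOfT (C P : Ideal (MvPolynomial (MVar v n) K)) : Prop :=
  ∃ A : Set (Fin v → ℕ), (∀ a ∈ A, ∀ i, a i ≤ n i + 1) ∧
    C = Ideal.span ((fun a => monomial (Tmono v n a) (1 : K)) '' A) ∧
    P = Ideal.span ((fun a => monomial (polExp v n a) (1 : K)) '' A)

/-- `ψ` is an identification of the quotient of `S` by the `ℤ^v`-graded ideal `Q` with a
standard `ℤ^v`-graded polynomial ring, compatible with the gradings. -/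
def IsGradedStructureIso {n₂ : Fin v → ℕ} (Q : Ideal (MvPolynomial (MVar v n) K))
    (ψ : (MvPolynomial (MVar v n) K ⧸ Q) ≃ₐ[K] MvPolynomial (MVar v n₂) K) : Prop :=
  ∀ (f : MvPolynomial (MVar v n) K) (a : Fin v → ℕ),
    f.IsWeightedHomogeneous (wt v n) a →
      (ψ (Ideal.Quotient.mk Q f)).IsWeightedHomogeneous (wt v n₂) a

end CSPaper

namespace CSPaper

section Combinatorics

variable {v : ℕ} {n : Fin v → ℕ}

/-- The number of variables of each row that belong to `F`. -/
def rowCount (F : Finset (MVar v n)) (i : Fin v) : ℕ :=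
  (Finset.univ.filter fun j : Fin (n i + 1) => (⟨i, j⟩ : MVar v n) ∈ F).card

lemma weight_wt_apply (s : MVar v n →₀ ℕ) (i : Fin v) :
    Finsupp.weight (wt v n) s i = ∑ j : Fin (n i + 1), s ⟨i, j⟩ := by
  rw [Finsupp.weight_apply, Finsupp.sum_fintype _ _ (by simp), Finset.sum_apply,
    Fintype.sum_sigma, Finset.sum_eq_single i]
  · simp [wt]
  · intro k _ hk
    simp [wt, hk.symm]
  · simp

lemma finite_weight_eq (a : Fin v → ℕ) :
    {s : MVar v n →₀ ℕ | Finsupp.weight (wt v n) s = a}.Finite := by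
  refine (Set.finite_Iic (Finsupp.equivFunOnFinite.symm fun x : MVar v n => a x.1)).subset ?_
  rintro s rfl x
  simp only [Finsupp.equivFunOnFinite_symm_apply_apply, weight_wt_apply]
  exact Finset.single_le_sum (f := fun j => s ⟨x.1, j⟩) (fun _ _ => Nat.zero_le _)
    (Finset.mem_univ x.2)

/-- The number of monomials with support `F` and multidegree `a`. -/
def numMonomials (F : Finset (MVar v n)) (a : Fin v → ℕ) : ℕ :=
  ((finite_weight_eq a).toFinset.filter fun s : MVar v n →₀ ℕ => s.support = F).card

lemma numMonomials_eq_of_rowCount_eq {F G : Finset (MVar v n)} (h : rowCount F = rowCount G)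
    (a : Fin v → ℕ) : numMonomials F a = numMonomials G a := by
  choose e he using fun i => Equiv.Perm.exists_map_finset_eq
    (Finset.univ.filter fun j : Fin (n i + 1) => (⟨i, j⟩ : MVar v n) ∈ F)
    (Finset.univ.filter fun j : Fin (n i + 1) => (⟨i, j⟩ : MVar v n) ∈ G) (congrFun h i)
  have heFG (i : Fin v) (j : Fin (n i + 1)) :
      (⟨i, e i j⟩ : MVar v n) ∈ G ↔ (⟨i, j⟩ : MVar v n) ∈ F := by
    have := congrArg (e i j ∈ ·) (he i)
    simpa using this.symm
  let E : Equiv.Perm (MVar v n) := Equiv.sigmaCongrRight e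
  refine Finset.card_equiv (Finsupp.domCongr E).toEquiv fun s => ?_
  have hw : Finsupp.weight (wt v n) (Finsupp.domCongr E s) = Finsupp.weight (wt v n) s := by
    ext i
    rw [weight_wt_apply, weight_wt_apply]
    exact (Equiv.sum_comp (e i) _).symm.trans (by simp [E])
  have hs : (Finsupp.domCongr E s).support = G ↔ s.support = F := by
    simp only [Finset.ext_iff]
    rw [← E.forall_congr_right]
    refine forall_congr' fun x => ?_
    have := heFG x.1 x.2
    simp_all [E]
  simp only [Finset.mem_filter, Set.Finite.mem_toFinset, Set.mem_ofPred_eq]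
  exact and_congr (by rw [← hw]; rfl) hs.symm

lemma rowCount_le_of_numMonomials_ne_zero {F : Finset (MVar v n)} {a : Fin v → ℕ}
    (h : numMonomials F a ≠ 0) : rowCount F ≤ a := by
  obtain ⟨s, hs⟩ := Finset.card_ne_zero.mp h
  simp only [Finset.mem_filter, Set.Finite.mem_toFinset, Set.mem_ofPred_eq] at hs
  obtain ⟨rfl, rfl⟩ := hs
  intro i
  rw [weight_wt_apply, rowCount, Finset.card_filter]
  refine Finset.sum_le_sum fun j _ => ?_
  by_cases hj : s ⟨i, j⟩ = 0 <;> simp [hj]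
  omega

/-- The exponent of the squarefree monomial `∏ x ∈ F, x`. -/
def sqfreeExp (F : Finset (MVar v n)) : MVar v n →₀ ℕ := Finsupp.indicator F fun _ _ => 1

lemma sqfreeExp_apply (F : Finset (MVar v n)) (x : MVar v n) :
    sqfreeExp F x = if x ∈ F then 1 else 0 := by
  simp [sqfreeExp, Finsupp.indicator_apply]

lemma support_sqfreeExp (F : Finset (MVar v n)) : (sqfreeExp F).support = F := by
  ext x
  simp [sqfreeExp_apply]

lemma sqfreeExp_le_iff {F : Finset (MVar v n)} {s : MVar v n →₀ ℕ} :
    sqfreeExp F ≤ s ↔ F ⊆ s.support := by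
  refine forall_congr' fun x => ?_
  by_cases hx : x ∈ F <;> simp [sqfreeExp_apply, hx, Nat.one_le_iff_ne_zero]

lemma numMonomials_rowCount_ne_zero (F : Finset (MVar v n)) :
    numMonomials F (rowCount F) ≠ 0 := by
  refine Finset.card_ne_zero.mpr ⟨sqfreeExp F, ?_⟩
  simp only [Finset.mem_filter, Set.Finite.mem_toFinset, Set.mem_ofPred_eq, support_sqfreeExp,
    and_true]
  ext i
  simp [weight_wt_apply, sqfreeExp_apply, rowCount]

/-- A triangular system of weighted counts determines the fibre cardinalities. -/
lemma card_fiber_eq_of_sum_eq {α P : Type*} [PartialOrder P] [WellFoundedLT P] [DecidableEq P]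
    (c : α → P) (N : α → P → ℕ) (hN : ∀ x y, c x = c y → N x = N y)
    (hle : ∀ x p, N x p ≠ 0 → c x ≤ p) (hdiag : ∀ x, N x (c x) ≠ 0) (U V : Finset α)
    (h : ∀ p, ∑ x ∈ U, N x p = ∑ x ∈ V, N x p) (p : P) :
    (U.filter fun x => c x = p).card = (V.filter fun x => c x = p).card := by
  classical
  induction p using WellFoundedLT.induction with
  | ind p ih =>
    by_cases hp : ∃ x, c x = p
    swap
    · push Not at hp
      simp [hp]
    obtain ⟨y, rfl⟩ := hp
    have fiberwise (W : Finset α) (hW : W ⊆ U ∪ V) : ∑ x ∈ W, N x (c y) =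
        (W.filter fun x => c x = c y).card * N y (c y) +
          ∑ q ∈ ((U ∪ V).image c).erase (c y), ∑ x ∈ W with c x = q, N x (c y) := by
      have hmaps : ∀ x ∈ W, c x ∈ insert (c y) ((U ∪ V).image c) := fun x hx =>
        Finset.mem_insert_of_mem (Finset.mem_image_of_mem c (hW hx))
      rw [← Finset.sum_fiberwise_of_maps_to hmaps,
        ← Finset.add_sum_erase _ _ (Finset.mem_insert_self (c y) _), Finset.erase_insert_eq_erase]
      congr 1
      refine Finset.sum_const_nat fun x hx => ?_
      rw [hN x y (Finset.mem_filter.mp hx).2]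
    have hrest : ∀ q ∈ ((U ∪ V).image c).erase (c y),
        ∑ x ∈ U with c x = q, N x (c y) = ∑ x ∈ V with c x = q, N x (c y) := by
      intro q hq
      obtain ⟨hqy, hq⟩ := Finset.mem_erase.mp hq
      obtain ⟨z, -, rfl⟩ := Finset.mem_image.mp hq
      have hconst (W : Finset α) : ∑ x ∈ W with c x = c z, N x (c y) =
          (W.filter fun x => c x = c z).card * N z (c y) :=
        Finset.sum_const_nat fun x hx => by rw [hN x z (Finset.mem_filter.mp hx).2]
      rw [hconst, hconst]
      by_cases hz : N z (c y) = 0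
      · simp [hz]
      · rw [ih (c z) (lt_of_le_of_ne (hle z _ hz) hqy)]
    have key := h (c y)
    rw [fiberwise U Finset.subset_union_left, fiberwise V Finset.subset_union_right,
      Finset.sum_congr rfl hrest] at key
    exact Nat.eq_of_mul_eq_mul_right (Nat.pos_of_ne_zero (hdiag y)) (Nat.add_right_cancel key)

lemma sum_eq_of_card_fiber_eq {α P : Type*} [DecidableEq P] (c : α → P) (f : α → ℕ)
    (hf : ∀ x y, c x = c y → f x = f y) (U V : Finset α)
    (h : ∀ p, (U.filter fun x => c x = p).card = (V.filter fun x => c x = p).card) :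
    ∑ x ∈ U, f x = ∑ x ∈ V, f x := by
  have hg : f = fun x => Function.extend c f 0 (c x) :=
    funext fun x => ((Function.FactorsThrough.extend_apply fun a b => hf a b) 0 x).symm
  have himage : U.image c = V.image c := by
    ext p
    rw [← Finset.fiber_nonempty_iff_mem_image, ← Finset.fiber_nonempty_iff_mem_image,
      ← Finset.card_pos, ← Finset.card_pos, h]
  rw [hg, Finset.sum_comp, Finset.sum_comp, himage]
  simp only [h]

lemma rowCount_add_rowCount_compl (F : Finset (MVar v n)) (i : Fin v) :
    rowCount F i + rowCount Fᶜ i = n i + 1 := by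
  simp only [rowCount, Finset.mem_compl]
  rw [Finset.card_filter_add_card_filter_not]
  simp

lemma rowCount_compl_eq_iff {F G : Finset (MVar v n)} :
    rowCount Fᶜ = rowCount G ↔ rowCount F = rowCount Gᶜ := by
  simp only [funext_iff]
  refine forall_congr' fun i => ?_
  have := rowCount_add_rowCount_compl F i
  have := rowCount_add_rowCount_compl G i
  omega

open Classical in
lemma card_fiber_dual_eq {U V : Finset (MVar v n) → Prop}
    (h : ∀ p, (Finset.univ.filter fun F => U F ∧ rowCount F = p).card =
      (Finset.univ.filter fun F => V F ∧ rowCount F = p).card) (p : Fin v → ℕ) :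
    (Finset.univ.filter fun F : Finset (MVar v n) => ¬ U Fᶜ ∧ rowCount F = p).card =
      (Finset.univ.filter fun F : Finset (MVar v n) => ¬ V Fᶜ ∧ rowCount F = p).card := by
  by_cases hp : ∃ G : Finset (MVar v n), rowCount G = p
  swap
  · push Not at hp
    simp [hp]
  obtain ⟨G, rfl⟩ := hp
  have hsplit (W : Finset (MVar v n) → Prop) :
      (Finset.univ.filter fun F => W F ∧ rowCount F = rowCount Gᶜ).card +
        (Finset.univ.filter fun F => ¬ W Fᶜ ∧ rowCount F = rowCount G).card =
      (Finset.univ.filter fun F : Finset (MVar v n) => rowCount F = rowCount Gᶜ).card := by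
    have hcompl : (Finset.univ.filter fun F => ¬ W Fᶜ ∧ rowCount F = rowCount G).card =
        (Finset.univ.filter fun F => ¬ W F ∧ rowCount F = rowCount Gᶜ).card :=
      Finset.card_equiv (Equiv.mk compl compl compl_compl compl_compl) fun F => by
        simp [rowCount_compl_eq_iff]
    rw [hcompl, ← Finset.card_filter_add_card_filter_not
      (s := Finset.univ.filter fun F : Finset (MVar v n) => rowCount F = rowCount Gᶜ) W,
      Finset.filter_filter, Finset.filter_filter]
    simp only [and_comm]
  have := hsplit U
  have := hsplit V
  have := h (rowCount Gᶜ)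
  omega

end Combinatorics

section Ideals

variable {K : Type} [Field K] {v : ℕ} {n : Fin v → ℕ}

/-- `I` is spanned by the monomials whose support satisfies `U`. -/
def SupportedOn (I : Ideal (MvPolynomial (MVar v n) K)) (U : Finset (MVar v n) → Prop) : Prop :=
  ∀ f, f ∈ I ↔ ∀ s ∈ f.support, U s.support

open Classical in
lemma SupportedOn.hilb_eq {I : Ideal (MvPolynomial (MVar v n) K)}
    {U : Finset (MVar v n) → Prop} (h : SupportedOn I U) (a : Fin v → ℕ) :
    hilb I a = ∑ F ∈ Finset.univ.filter U, numMonomials F a := by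
  have hsub : (Submodule.restrictScalars K I ⊓ weightedHomogeneousSubmodule K (wt v n) a :
      Submodule K (MvPolynomial (MVar v n) K)) =
      restrictSupport K ↑((finite_weight_eq a).toFinset.filter
        fun s : MVar v n →₀ ℕ => U s.support) := by
    ext f
    simp only [Submodule.mem_inf, Submodule.restrictScalars_mem, mem_weightedHomogeneousSubmodule,
      IsWeightedHomogeneous, h f, mem_restrictSupport_iff, Set.subset_def, Finset.mem_coe,
      Finset.mem_filter, Set.Finite.mem_toFinset, Set.mem_ofPred_eq, mem_support_iff]
    exact ⟨fun hf s hs => ⟨hf.2 hs, hf.1 s hs⟩,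
      fun hf => ⟨fun s hs => (hf s hs).2, fun s hs => (hf s hs).1⟩⟩
  rw [hilb, hsub, Module.finrank_eq_nat_card_basis (basisRestrictSupport K _),
    Nat.card_eq_card_toFinset, Finset.toFinset_coe,
    Finset.card_eq_sum_card_fiberwise (f := Finsupp.support) (t := Finset.univ.filter U)
      fun s hs => by simpa using (Finset.mem_filter.mp hs).2]
  refine Finset.sum_congr rfl fun F hF => ?_
  rw [numMonomials, Finset.filter_filter]
  congr 1
  refine Finset.filter_congr fun s _ => ⟨And.right, ?_⟩
  rintro rfl
  exact ⟨(Finset.mem_filter.mp hF).2, rfl⟩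

open Classical in
lemma SupportedOn.sameHS_iff {I J : Ideal (MvPolynomial (MVar v n) K)}
    {U V : Finset (MVar v n) → Prop} (hI : SupportedOn I U) (hJ : SupportedOn J V) :
    sameHS I J ↔ ∀ p, (Finset.univ.filter fun F => U F ∧ rowCount F = p).card =
      (Finset.univ.filter fun F => V F ∧ rowCount F = p).card := by
  simp only [sameHS, hI.hilb_eq, hJ.hilb_eq, ← Finset.filter_filter]
  constructor
  · intro h
    exact card_fiber_eq_of_sum_eq rowCount numMonomials
      (fun F G hFG => funext (numMonomials_eq_of_rowCount_eq hFG))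
      (fun F a => rowCount_le_of_numMonomials_ne_zero) numMonomials_rowCount_ne_zero _ _ h
  · intro h a
    exact sum_eq_of_card_fiber_eq rowCount _
      (fun F G hFG => numMonomials_eq_of_rowCount_eq hFG a) _ _ h

lemma prod_X_eq_monomial (F : Finset (MVar v n)) :
    ∏ x ∈ F, (X x : MvPolynomial (MVar v n) K) = monomial (sqfreeExp F) 1 := by
  rw [monomial_eq, Finsupp.prod, support_sqfreeExp, C_1, one_mul]
  refine Finset.prod_congr rfl fun x hx => ?_
  simp [sqfreeExp_apply, hx]

lemma SupportedOn.prod_X_mem_iff {I : Ideal (MvPolynomial (MVar v n) K)}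
    {U : Finset (MVar v n) → Prop} (h : SupportedOn I U) (F : Finset (MVar v n)) :
    ∏ x ∈ F, X x ∈ I ↔ U F := by
  rw [prod_X_eq_monomial, h]
  simp [support_sqfreeExp]

lemma SupportedOn.mono {I : Ideal (MvPolynomial (MVar v n) K)}
    {U : Finset (MVar v n) → Prop} (h : SupportedOn I U) {F G : Finset (MVar v n)}
    (hFG : F ⊆ G) (hF : U F) : U G := by
  rw [← h.prod_X_mem_iff] at hF ⊢
  exact I.mem_of_dvd (Finset.prod_dvd_prod_of_subset F G _ hFG) hF

lemma IsSqfreeMonomialIdeal.exists_supportedOn {I : Ideal (MvPolynomial (MVar v n) K)}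
    (hI : IsSqfreeMonomialIdeal I) : ∃ U, SupportedOn I U := by
  obtain ⟨A, hA, rfl⟩ := hI
  refine ⟨fun F => ∃ t ∈ A, t.support ⊆ F, fun f => ?_⟩
  rw [mem_ideal_span_monomial_image]
  refine forall₂_congr fun s _ => exists_congr fun t => and_congr_right fun ht => ?_
  refine ⟨Finsupp.support_mono, fun hts x => ?_⟩
  by_cases hx : t x = 0
  · simp [hx]
  · exact (hA t ht x).trans
      (Nat.one_le_iff_ne_zero.mpr (Finsupp.mem_support_iff.mp (hts (by simpa using hx))))

lemma isPrime_span_X_image {σ R : Type*} [CommRing R] [IsDomain R] (F : Set σ) :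
    (Ideal.span ((X : σ → MvPolynomial σ R) '' F)).IsPrime := by
  classical
  let φ : MvPolynomial σ R →ₐ[R] MvPolynomial σ R := aeval fun x => if x ∈ F then 0 else X x
  have hcomp : (Ideal.Quotient.mkₐ R (Ideal.span (X '' F))).comp φ =
      Ideal.Quotient.mkₐ R (Ideal.span (X '' F)) := by
    refine algHom_ext fun x => ?_
    by_cases hx : x ∈ F
    · have : (Ideal.Quotient.mk (Ideal.span (X '' F))) (X x : MvPolynomial σ R) = 0 :=
        Ideal.Quotient.eq_zero_iff_mem.mpr (Ideal.subset_span (Set.mem_image_of_mem _ hx))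
      simp [φ, hx, this]
    · simp [φ, hx]
  have hker : RingHom.ker φ = Ideal.span (X '' F) := by
    refine le_antisymm (fun f hf => ?_) (Ideal.span_le.mpr ?_)
    · have := DFunLike.congr_fun hcomp f
      rw [AlgHom.comp_apply, RingHom.mem_ker.mp hf, map_zero] at this
      exact Ideal.Quotient.eq_zero_iff_mem.mp this.symm
    · rintro _ ⟨x, hx, rfl⟩
      simp [φ, hx]
  exact hker ▸ RingHom.ker_isPrime φ

lemma X_mem_span_X_image_iff {F : Finset (MVar v n)} {x : MVar v n} :
    (X x : MvPolynomial (MVar v n) K) ∈ Ideal.span (X '' (F : Set (MVar v n))) ↔ x ∈ F := by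
  rw [mem_ideal_span_X_image]
  simp only [support_X, Finset.mem_singleton, forall_eq, Finsupp.single_apply]
  aesop

lemma SupportedOn.le_span_X_iff {I : Ideal (MvPolynomial (MVar v n) K)}
    {U : Finset (MVar v n) → Prop} (h : SupportedOn I U) {F : Finset (MVar v n)} :
    I ≤ Ideal.span (X '' (F : Set (MVar v n))) ↔ ¬ U Fᶜ := by
  constructor
  · intro hle hU
    have hprime := isPrime_span_X_image (R := K) (F : Set (MVar v n))
    obtain ⟨x, hx, hxF⟩ := hprime.prod_mem_iff.mp (hle ((h.prod_X_mem_iff _).mpr hU))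
    exact Finset.mem_compl.mp hx (X_mem_span_X_image_iff.mp hxF)
  · intro hU f hf
    rw [mem_ideal_span_X_image]
    intro s hs
    by_contra! hx
    refine hU (h.mono (fun x hxs => ?_) ((h f).mp hf s hs))
    rw [Finset.mem_compl]
    exact fun hxF => Finsupp.mem_support_iff.mp hxs (hx x hxF)

lemma SupportedOn.exists_minimalPrime_iff {I : Ideal (MvPolynomial (MVar v n) K)}
    {U : Finset (MVar v n) → Prop} (h : SupportedOn I U) {G : Finset (MVar v n)} :
    (∃ F : Finset (MVar v n), Ideal.span (X '' (F : Set (MVar v n))) ∈ I.minimalPrimes ∧ F ⊆ G) ↔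
      ¬ U Gᶜ := by
  classical
  constructor
  · rintro ⟨F, hF, hFG⟩ hU
    exact h.le_span_X_iff.mp hF.1.2 (h.mono (Finset.compl_subset_compl.mpr hFG) hU)
  · intro hU
    obtain ⟨F, hFG, hF⟩ := (Set.toFinite {F : Finset (MVar v n) | ¬ U Fᶜ}).exists_le_minimal hU
    refine ⟨F, ⟨⟨isPrime_span_X_image _, h.le_span_X_iff.mpr hF.1⟩, fun Q hQ hQF => ?_⟩, hFG⟩
    obtain ⟨hQprime, hIQ⟩ := hQ
    let F' := Finset.univ.filter fun x => (X x : MvPolynomial (MVar v n) K) ∈ Q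
    have hF'F : F' ≤ F := fun x hx =>
      X_mem_span_X_image_iff.mp (hQF (Finset.mem_filter.mp hx).2)
    have hF' : ¬ U F'ᶜ := fun hU' => by
      obtain ⟨x, hx, hxQ⟩ := hQprime.prod_mem_iff.mp (hIQ ((h.prod_X_mem_iff _).mpr hU'))
      exact Finset.mem_compl.mp hx (Finset.mem_filter.mpr ⟨Finset.mem_univ x, hxQ⟩)
    rw [Ideal.span_le]
    rintro _ ⟨x, hx, rfl⟩
    exact (Finset.mem_filter.mp (hF.2 hF' hF'F hx)).2

lemma SupportedOn.alexanderDual {I Istar : Ideal (MvPolynomial (MVar v n) K)}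
    {U : Finset (MVar v n) → Prop} (h : SupportedOn I U) (hdual : IsAlexanderDual I Istar) :
    SupportedOn Istar fun F => ¬ U Fᶜ := by
  have hspan : Istar = Ideal.span ((fun s => monomial s (1 : K)) '' (sqfreeExp ''
      {F : Finset (MVar v n) | Ideal.span (X '' (F : Set (MVar v n))) ∈ I.minimalPrimes})) := by
    rw [hdual, Set.image_image]
    congr 1
    ext m
    simp [prod_X_eq_monomial, eq_comm]
  intro f
  rw [hspan, mem_ideal_span_monomial_image]
  refine forall₂_congr fun s _ => ?_
  simp only [← h.exists_minimalPrime_iff]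
  simp [sqfreeExp_le_iff]

end Ideals

end CSPaper

open CSPaper

/-- **Alexander inversion.** If two squarefree monomial ideals of `S` have the same
`ℤ^v`-graded Hilbert series, then so do their Alexander duals. -/
theorem alexander_dual_same_hilbert_series
    {K : Type} [Field K] [Infinite K] {v : ℕ} {n : Fin v → ℕ}
    (I J Istar Jstar : Ideal (MvPolynomial (MVar v n) K))
    (hI : IsSqfreeMonomialIdeal I) (hJ : IsSqfreeMonomialIdeal J)
    (hHS : sameHS I J)
    (hIstar : IsAlexanderDual I Istar) (hJstar : IsAlexanderDual J Jstar) :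
    sameHS Istar Jstar := by
  obtain ⟨U, hU⟩ := hI.exists_supportedOn
  obtain ⟨V, hV⟩ := hJ.exists_supportedOn
  refine ((hU.alexanderDual hIstar).sameHS_iff (hV.alexanderDual hJstar)).mpr fun p => ?_
  convert card_fiber_dual_eq ((hU.sameHS_iff hV).mp hHS) p

end
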